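/- arXiv:2409.14391 — 3 statements merged into one kernel-verified Lean document; each statement's English description precedes it below -/
import Mathlib

section
/- Let a, b > 0 with a ≠ b and set μ = min(a,b). Then as t → 0⁺, the Neumann heat trace of the rectangle [0,a]×[0,b] satisfies ∑_{m≥0}∑_{n≥0} exp(−π²(m²/a² + n²/b²) t) = ab/(4πt) + (a+b)/(4√(πt)) + 1/4 + (ab/(2πt))·e^{−μ²/t} + (μ/(2√(πt)))·e^{−μ²/t} + O(t^{−1} e^{−c/t}), where c = min(max(a,b)², 4·min(a,b)²). -/
open Real Filter Asymptotics
open scoped Topology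

lemma summable_exp_neg_mul_nat_sq {c : ℝ} (hc : 0 < c) :
    Summable fun n : ℕ => Real.exp (-c * (n : ℝ) ^ 2) :=
  Real.summable_exp_nat_mul_of_ge (neg_lt_zero.mpr hc)
    fun n => by exact_mod_cast Nat.le_self_pow two_ne_zero n

lemma tsum_int_exp_neg_mul_sq {c : ℝ} (hc : 0 < c) :
    ∑' n : ℤ, Real.exp (-c * (n : ℝ) ^ 2) = 2 * ∑' n : ℕ, Real.exp (-c * (n : ℝ) ^ 2) - 1 := by
  have hs := summable_exp_neg_mul_nat_sq hc
  have hs' := (summable_nat_add_iff 1).mpr hs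
  have h := hs.tsum_eq_zero_add
  have hz := tsum_of_nat_of_neg_add_one (f := fun n : ℤ => Real.exp (-c * (n : ℝ) ^ 2))
    (by simpa using hs) (by simpa [← neg_add_rev, add_comm] using hs')
  have hneg : ∀ n : ℕ, (((-((n : ℤ) + 1) : ℤ) : ℝ)) ^ 2 = (((n + 1 : ℕ) : ℝ)) ^ 2 := by
    intro n; push_cast; ring
  simp only [hneg, Int.cast_natCast] at hz
  simp only [Nat.cast_zero, ne_eq, two_ne_zero, not_false_eq_true, zero_pow, mul_zero,
    Real.exp_zero] at h
  linarith

/-- The Poisson summation formula for a Gaussian, as a sum over the natural numbers. -/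
lemma tsum_nat_exp_neg_mul_sq {a t : ℝ} (ha : 0 < a) (ht : 0 < t) :
    ∑' n : ℕ, Real.exp (-(π ^ 2 * t / a ^ 2) * (n : ℝ) ^ 2)
      = 1 / 2 + a * (√(π * t))⁻¹
        * (∑' n : ℕ, Real.exp (-(a ^ 2 / t) * (n : ℝ) ^ 2) - 1 / 2) := by
  have hα : 0 < π * t / a ^ 2 := by positivity
  have h := Real.tsum_exp_neg_mul_int_sq hα
  have e₁ : -π * (π * t / a ^ 2) = -(π ^ 2 * t / a ^ 2) := by ring
  have e₂ : -π / (π * t / a ^ 2) = -(a ^ 2 / t) := by field_simp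
  have e₃ : (1 : ℝ) / (π * t / a ^ 2) ^ (1 / 2 : ℝ) = a * (√(π * t))⁻¹ := by
    rw [← Real.sqrt_eq_rpow, Real.sqrt_div (by positivity), Real.sqrt_sq ha.le, one_div_div,
      div_eq_mul_inv]
  rw [e₁, e₂, e₃, tsum_int_exp_neg_mul_sq (by positivity),
    tsum_int_exp_neg_mul_sq (by positivity)] at h
  linear_combination h / 2

lemma tsum_nat_exp_neg_mul_sq_sub_isBigO {a : ℝ} (ha : 0 < a) :
    (fun t : ℝ => ∑' n : ℕ, Real.exp (-(a ^ 2 / t) * (n : ℝ) ^ 2) - 1 - Real.exp (-a ^ 2 / t))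
      =O[𝓝[>] (0 : ℝ)] fun t => Real.exp (-(4 * a ^ 2) / t) := by
  have ha2 : 0 < a ^ 2 := by positivity
  refine IsBigO.of_bound (∑' n : ℕ, Real.exp (-a ^ 2 * (n : ℝ) ^ 2)) ?_
  filter_upwards [Ioc_mem_nhdsGT (zero_lt_one' ℝ)] with t ⟨ht, ht1⟩
  have hc : 0 < a ^ 2 / t := by positivity
  have hs := summable_exp_neg_mul_nat_sq hc
  have hs' := (summable_nat_add_iff 2).mpr hs
  have h := hs.sum_add_tsum_nat_add 2
  simp only [Finset.sum_range_succ, Finset.sum_range_zero] at h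
  have htail : ∑' n : ℕ, Real.exp (-(a ^ 2 / t) * (n : ℝ) ^ 2) - 1 - Real.exp (-a ^ 2 / t)
      = ∑' n : ℕ, Real.exp (-(a ^ 2 / t) * ((n + 2 : ℕ) : ℝ) ^ 2) := by
    rw [← h]; norm_num [neg_div]; ring
  rw [htail, Real.norm_of_nonneg (tsum_nonneg fun _ => (Real.exp_pos _).le),
    Real.norm_of_nonneg (Real.exp_pos _).le, ← tsum_mul_right]
  refine hs'.tsum_le_tsum (fun n => ?_) ((summable_exp_neg_mul_nat_sq ha2).mul_right _)
  rw [← Real.exp_add, Real.exp_le_exp]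
  have hle : a ^ 2 ≤ a ^ 2 / t := le_div_self ha2.le ht ht1
  have hn : (0 : ℝ) ≤ n := n.cast_nonneg
  have e : -(4 * a ^ 2) / t = -(4 * (a ^ 2 / t)) := by ring
  rw [e]
  push_cast
  nlinarith [mul_le_mul_of_nonneg_right hle (sq_nonneg (n : ℝ)), mul_nonneg hc.le hn]

lemma one_isBigO_inv_sqrt_pi_mul :
    (fun _ : ℝ => (1 : ℝ)) =O[𝓝[>] (0 : ℝ)] fun t => (√(π * t))⁻¹ := by
  refine IsBigO.of_bound 2 ?_
  filter_upwards [Ioc_mem_nhdsGT (zero_lt_one' ℝ)] with t ⟨ht, ht1⟩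
  have hpos : 0 < √(π * t) := Real.sqrt_pos.mpr (by positivity)
  have hle : √(π * t) ≤ 2 :=
    Real.sqrt_le_iff.mpr ⟨by norm_num, by nlinarith [Real.pi_le_four, Real.pi_pos]⟩
  rw [norm_one, Real.norm_of_nonneg (by positivity), ← div_eq_mul_inv]
  exact (one_le_div hpos).mpr hle

lemma inv_sqrt_pi_mul_mul_self {t : ℝ} (ht : 0 < t) :
    (√(π * t))⁻¹ * (√(π * t))⁻¹ = π⁻¹ * t⁻¹ := by
  rw [← mul_inv, Real.mul_self_sqrt (by positivity), mul_inv]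

lemma exp_neg_div_isBigO_of_le {c d : ℝ} (h : c ≤ d) :
    (fun t : ℝ => Real.exp (-d / t)) =O[𝓝[>] (0 : ℝ)] fun t => Real.exp (-c / t) := by
  refine IsBigO.of_bound 1 ?_
  filter_upwards [self_mem_nhdsWithin] with t (ht : 0 < t)
  rw [Real.norm_of_nonneg (Real.exp_pos _).le, Real.norm_of_nonneg (Real.exp_pos _).le, one_mul]
  gcongr

/-- The Neumann heat trace of a rectangle is the product of those of its sides. -/
lemma rectangle_heat_trace_eq_mul (a b t : ℝ) :
    ∑' (m : ℕ) (n : ℕ), Real.exp (-(π ^ 2 * ((m : ℝ) ^ 2 / a ^ 2 + (n : ℝ) ^ 2 / b ^ 2)) * t)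
      = (∑' m : ℕ, Real.exp (-(π ^ 2 * t / a ^ 2) * (m : ℝ) ^ 2))
        * ∑' n : ℕ, Real.exp (-(π ^ 2 * t / b ^ 2) * (n : ℝ) ^ 2) := by
  rw [← tsum_mul_right]
  refine tsum_congr fun m => ?_
  rw [← tsum_mul_left]
  refine tsum_congr fun n => ?_
  rw [← Real.exp_add]
  congr 1
  ring

lemma rectangle_heat_trace_isBigO_of_lt {a b : ℝ} (ha : 0 < a) (hab : a < b) :
    (fun t : ℝ =>
      (∑' m : ℕ, Real.exp (-(π ^ 2 * t / a ^ 2) * (m : ℝ) ^ 2))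
          * (∑' n : ℕ, Real.exp (-(π ^ 2 * t / b ^ 2) * (n : ℝ) ^ 2))
        - (a * b / (4 * π * t) + (a + b) / (4 * √(π * t)) + 1 / 4
            + a * b / (2 * π * t) * Real.exp (-a ^ 2 / t)
            + a / (2 * √(π * t)) * Real.exp (-a ^ 2 / t)))
      =O[𝓝[>] (0 : ℝ)]
    fun t : ℝ => t⁻¹ * Real.exp (-(min (b ^ 2) (4 * a ^ 2)) / t) := by
  have hb : 0 < b := ha.trans hab
  set e : ℝ → ℝ := fun t => Real.exp (-(min (b ^ 2) (4 * a ^ 2)) / t) with he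
  set r : ℝ → ℝ := fun t => (√(π * t))⁻¹ with hr
  set E : ℝ → ℝ := fun t => Real.exp (-a ^ 2 / t) with hE
  set R : ℝ → ℝ := fun t =>
    ∑' n : ℕ, Real.exp (-(a ^ 2 / t) * (n : ℝ) ^ 2) - 1 - Real.exp (-a ^ 2 / t) with hR
  set F : ℝ → ℝ := fun t => ∑' n : ℕ, Real.exp (-(b ^ 2 / t) * (n : ℝ) ^ 2) - 1 with hF
  have hRe : R =O[𝓝[>] (0 : ℝ)] e :=
    (tsum_nat_exp_neg_mul_sq_sub_isBigO ha).trans (exp_neg_div_isBigO_of_le (min_le_right _ _))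
  have hFe : F =O[𝓝[>] (0 : ℝ)] e := by
    have h₁ := (tsum_nat_exp_neg_mul_sq_sub_isBigO hb).trans
      (exp_neg_div_isBigO_of_le (show b ^ 2 ≤ 4 * b ^ 2 by nlinarith [sq_nonneg b]))
    refine IsBigO.trans ?_ (exp_neg_div_isBigO_of_le (min_le_left (b ^ 2) (4 * a ^ 2)))
    simpa [hF] using h₁.add (isBigO_refl (fun t : ℝ => Real.exp (-b ^ 2 / t)) _)
  have hE1 : E =O[𝓝[>] (0 : ℝ)] fun _ => (1 : ℝ) := by
    simpa only [neg_zero, zero_div, Real.exp_zero] using exp_neg_div_isBigO_of_le (sq_nonneg a)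
  have he1 : e =O[𝓝[>] (0 : ℝ)] fun _ => (1 : ℝ) := by
    simpa only [neg_zero, zero_div, Real.exp_zero] using
      exp_neg_div_isBigO_of_le (show (0 : ℝ) ≤ min (b ^ 2) (4 * a ^ 2) by positivity)
  have hconst : ∀ k : ℝ, (fun _ : ℝ => k) =O[𝓝[>] (0 : ℝ)] r := fun k =>
    (isBigO_const_const k one_ne_zero _).trans one_isBigO_inv_sqrt_pi_mul
  have hrk : ∀ k : ℝ, (fun t => k * r t) =O[𝓝[>] (0 : ℝ)] r := fun k =>
    isBigO_const_mul_self k r _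
  have hrmul : ∀ (k : ℝ) {f : ℝ → ℝ}, f =O[𝓝[>] (0 : ℝ)] (fun _ => (1 : ℝ)) →
      (fun t => k * r t * f t) =O[𝓝[>] (0 : ℝ)] r := fun k f hf => by
    simpa using (hrk k).mul hf
  have hrr : (fun t => r t * r t) =O[𝓝[>] (0 : ℝ)] fun t => t⁻¹ :=
    (isBigO_const_mul_self π⁻¹ (fun t : ℝ => t⁻¹) _).congr'
      (by filter_upwards [self_mem_nhdsWithin] with t ht using (inv_sqrt_pi_mul_mul_self ht).symm)
      EventuallyEq.rfl
  have hrre : (fun t => r t * r t * e t) =O[𝓝[>] (0 : ℝ)] fun t => t⁻¹ * e t :=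
    hrr.mul (isBigO_refl e _)
  have hA : (fun t => a * r t * (1 / 2 + b / 2 * r t + b * r t * F t) * R t)
      =O[𝓝[>] (0 : ℝ)] fun t => r t * r t * e t :=
    ((hrk a).mul (((hconst _).add (hrk _)).add (hrmul b (hFe.trans he1)))).mul hRe
  have hB : (fun t => b * r t * (1 / 2 + a / 2 * r t + a * r t * E t) * F t)
      =O[𝓝[>] (0 : ℝ)] fun t => r t * r t * e t :=
    ((hrk b).mul (((hconst _).add (hrk _)).add (hrmul a hE1))).mul hFe
  refine ((hA.add hB).trans hrre).congr' ?_ EventuallyEq.rfl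
  filter_upwards [self_mem_nhdsWithin] with t (ht : 0 < t)
  rw [tsum_nat_exp_neg_mul_sq ha ht, tsum_nat_exp_neg_mul_sq hb ht]
  have hsq := inv_sqrt_pi_mul_mul_self ht
  have e₁ : a * b / (4 * π * t) = a * b / 4 * (r t * r t) := by
    rw [hr, hsq]; field_simp
  have e₂ : a * b / (2 * π * t) = a * b / 2 * (r t * r t) := by
    rw [hr, hsq]; field_simp
  have e₃ : (a + b) / (4 * √(π * t)) = (a + b) / 4 * r t := by
    simp only [hr]; field_simp
  have e₄ : a / (2 * √(π * t)) = a / 2 * r t := by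
    simp only [hr]; field_simp
  rw [e₁, e₂, e₃, e₄]
  simp only [hR, hF, hE, hr]
  ring

/-- **Sharp short-time asymptotics of the Neumann heat trace of a rectangle.**
For a rectangle `[0,a] × [0,b]` with `a ≠ b`, setting `μ = min a b`, as `t → 0⁺`:
`∑_{m,n ≥ 0} exp(−π²(m²/a² + n²/b²) t)
  = ab/(4πt) + (a+b)/(4√(πt)) + 1/4 + (ab/(2πt))·e^{−μ²/t} + (μ/(2√(πt)))·e^{−μ²/t}
    + O(t⁻¹ e^{−c/t})`,
where `c = min((max a b)², 4 (min a b)²)`. -/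
theorem rectangle_neumann_heat_trace_asymptotics
    (a b : ℝ) (ha : 0 < a) (hb : 0 < b) (hab : a ≠ b) :
    (fun t : ℝ =>
      (∑' (m : ℕ) (n : ℕ),
          Real.exp (-(π ^ 2 * ((m : ℝ) ^ 2 / a ^ 2 + (n : ℝ) ^ 2 / b ^ 2)) * t))
        - (a * b / (4 * π * t) + (a + b) / (4 * Real.sqrt (π * t)) + 1 / 4
            + a * b / (2 * π * t) * Real.exp (-(min a b) ^ 2 / t)
            + min a b / (2 * Real.sqrt (π * t)) * Real.exp (-(min a b) ^ 2 / t)))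
      =O[𝓝[>] (0 : ℝ)]
    (fun t : ℝ => t⁻¹ * Real.exp (-(min ((max a b) ^ 2) (4 * (min a b) ^ 2)) / t)) := by
  simp only [rectangle_heat_trace_eq_mul]
  rcases hab.lt_or_gt with h | h
  · simpa only [min_eq_left h.le, max_eq_right h.le] using rectangle_heat_trace_isBigO_of_lt ha h
  · simpa only [min_eq_right h.le, max_eq_left h.le, mul_comm b a, add_comm b a,
      mul_comm (∑' n : ℕ, Real.exp (-(π ^ 2 * _ / b ^ 2) * (n : ℝ) ^ 2))] using
      rectangle_heat_trace_isBigO_of_lt hb h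
end

section
/- Let a > 0. Then as t → 0⁺, ∑_{m≥1}∑_{n≥1} exp(−π²(m² + n²) t/a²) = a²/(4πt) − a/(2√(πt)) + 1/4 + (a²/(πt))·e^{−a²/t} − (a/√(πt))·e^{−a²/t} + O(t^{−1} e^{−2a²/t}). -/
open Real Filter Asymptotics
open scoped Topology

theorem summable_pow_succ_sq {q : ℝ} (h0 : 0 ≤ q) (h1 : q < 1) :
    Summable fun n : ℕ => q ^ ((n + 1) ^ 2) :=
  (summable_geometric_of_lt_one h0 h1).of_nonneg_of_le (fun _ => by positivity)
    fun n => pow_le_pow_of_le_one h0 h1.le (by nlinarith)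

theorem tsum_pow_succ_sq_sub_nonneg {q : ℝ} (h0 : 0 ≤ q) (h1 : q < 1) :
    0 ≤ ∑' n : ℕ, q ^ ((n + 1) ^ 2) - q := by
  have h := (summable_pow_succ_sq h0 h1).le_tsum 0 fun _ _ => by positivity
  simpa using h

theorem tsum_pow_succ_sq_sub_le {q : ℝ} (h0 : 0 ≤ q) (h1 : q ≤ 1 / 2) :
    ∑' n : ℕ, q ^ ((n + 1) ^ 2) - q ≤ 2 * q ^ 2 := by
  have hq : q < 1 := by linarith
  have hs := summable_pow_succ_sq h0 hq
  have hgeom : Summable fun n : ℕ => q ^ 2 * q ^ n :=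
    (summable_geometric_of_lt_one h0 hq).mul_left _
  have htail : ∑' n : ℕ, q ^ ((n + 1 + 1) ^ 2) ≤ ∑' n : ℕ, q ^ 2 * q ^ n := by
    refine ((summable_nat_add_iff 1).2 hs).tsum_le_tsum (fun n => ?_) hgeom
    rw [← pow_add]
    exact pow_le_pow_of_le_one h0 hq.le (by nlinarith)
  rw [tsum_mul_left, tsum_geometric_of_lt_one h0 hq] at htail
  have hinv : (1 - q)⁻¹ ≤ 2 := inv_le_of_inv_le₀ (by norm_num) (by linarith)
  rw [hs.tsum_eq_zero_add]
  simp only [zero_add, one_pow, pow_one, add_sub_cancel_left]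
  nlinarith [sq_nonneg q]

theorem exp_neg_mul_succ_sq (s : ℝ) (n : ℕ) :
    exp (-π * s * ((n : ℝ) + 1) ^ 2) = exp (-π * s) ^ ((n + 1) ^ 2) := by
  rw [← Real.exp_nat_mul]
  push_cast
  ring_nf

theorem summable_exp_neg_mul_succ_sq {s : ℝ} (hs : 0 < s) :
    Summable fun n : ℕ => exp (-π * s * ((n : ℝ) + 1) ^ 2) := by
  simp_rw [exp_neg_mul_succ_sq]
  exact summable_pow_succ_sq (exp_pos _).le (Real.exp_lt_one_iff.2 (by nlinarith [pi_pos]))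

theorem tsum_int_exp_neg_mul_sq_s2 {s : ℝ} (hs : 0 < s) :
    ∑' n : ℤ, exp (-π * s * (n : ℝ) ^ 2)
      = 1 + 2 * ∑' n : ℕ, exp (-π * s * ((n : ℝ) + 1) ^ 2) := by
  have h := (summable_exp_neg_mul_succ_sq hs).hasSum
  have h₂ := HasSum.of_add_one_of_neg_add_one (f := fun n : ℤ => exp (-π * s * (n : ℝ) ^ 2))
    (by simpa using h) (by simpa [-neg_add_rev, neg_sq] using h)
  rw [h₂.tsum_eq]
  simp only [Int.cast_zero, ne_eq, OfNat.ofNat_ne_zero, not_false_eq_true, zero_pow, mul_zero,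
    Real.exp_zero]
  ring_nf

/-- Poisson summation for the Gaussian, written for the one-sided sums. -/
theorem one_add_two_mul_tsum_exp_neg_mul_succ_sq {s : ℝ} (hs : 0 < s) :
    1 + 2 * ∑' n : ℕ, exp (-π * s * ((n : ℝ) + 1) ^ 2)
      = 1 / √s * (1 + 2 * ∑' n : ℕ, exp (-π * s⁻¹) ^ ((n + 1) ^ 2)) := by
  simp_rw [← exp_neg_mul_succ_sq]
  rw [← tsum_int_exp_neg_mul_sq_s2 hs, ← tsum_int_exp_neg_mul_sq_s2 (inv_pos.2 hs),
    Real.tsum_exp_neg_mul_int_sq hs, Real.sqrt_eq_rpow]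
  simp only [div_eq_mul_inv]

theorem tsum_tsum_exp_neg_mul_succ_sq (s : ℝ) :
    ∑' (m : ℕ) (n : ℕ), exp (-π * s * (((m : ℝ) + 1) ^ 2 + ((n : ℝ) + 1) ^ 2))
      = (∑' n : ℕ, exp (-π * s * ((n : ℝ) + 1) ^ 2)) ^ 2 := by
  simp_rw [mul_add (-π * s), Real.exp_add, tsum_mul_left, tsum_mul_right, sq]

theorem abs_theta_sq_sub_le {k q S T : ℝ} (hk : 1 ≤ k) (hq0 : 0 ≤ q) (hq : q ≤ 1 / 2)
    (hS : 1 + 2 * S = k * (1 + 2 * T)) (hT0 : 0 ≤ T - q) (hT : T - q ≤ 2 * q ^ 2) :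
    |S ^ 2 - (k ^ 2 / 4 - k / 2 + 1 / 4 + k ^ 2 * q - k * q)| ≤ 6 * (k ^ 2 * q ^ 2) := by
  obtain rfl : S = (k * (1 + 2 * T) - 1) / 2 := by linarith
  have herr : ((k * (1 + 2 * T) - 1) / 2) ^ 2
      - (k ^ 2 / 4 - k / 2 + 1 / 4 + k ^ 2 * q - k * q)
      = (k ^ 2 - k) * (T - q) + k ^ 2 * T ^ 2 := by ring
  have hkk : 0 ≤ k ^ 2 - k := by nlinarith
  have hT2 : T ≤ 2 * q := by nlinarith
  have h₁ : (k ^ 2 - k) * (T - q) ≤ k ^ 2 * (2 * q ^ 2) := by gcongr; linarith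
  have h₂ : k ^ 2 * T ^ 2 ≤ k ^ 2 * (2 * q) ^ 2 := by gcongr; linarith
  rw [herr, abs_of_nonneg (by positivity)]
  linarith

/-- **Sharp short-time asymptotics of the Dirichlet heat trace of a square of side `a`.**
As `t → 0⁺`:
`∑_{m,n ≥ 1} exp(−π²(m² + n²) t/a²)
  = a²/(4πt) − a/(2√(πt)) + 1/4 + (a²/(πt))·e^{−a²/t} − (a/√(πt))·e^{−a²/t}
    + O(t⁻¹ e^{−2a²/t})`. -/
theorem square_dirichlet_heat_trace_asymptotics (a : ℝ) (ha : 0 < a) :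
    (fun t : ℝ =>
      (∑' (m : ℕ) (n : ℕ),
          Real.exp (-(π ^ 2 * (((m : ℝ) + 1) ^ 2 + ((n : ℝ) + 1) ^ 2)) * t / a ^ 2))
        - (a ^ 2 / (4 * π * t) - a / (2 * Real.sqrt (π * t)) + 1 / 4
            + a ^ 2 / (π * t) * Real.exp (-a ^ 2 / t)
            - a / Real.sqrt (π * t) * Real.exp (-a ^ 2 / t)))
      =O[𝓝[>] (0 : ℝ)]
    (fun t : ℝ => t⁻¹ * Real.exp (-(2 * a ^ 2) / t)) := by
  refine IsBigO.of_bound (6 * (a ^ 2 / π)) ?_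
  filter_upwards [Ioc_mem_nhdsGT (show 0 < a ^ 2 / π by positivity)] with t ht
  obtain ⟨ht0, hta⟩ := ht
  have hπt : π * t ≤ a ^ 2 := by rwa [le_div_iff₀' pi_pos] at hta
  have hr : 0 < √(π * t) := Real.sqrt_pos.2 (by positivity)
  have hr2 : √(π * t) ^ 2 = π * t := Real.sq_sqrt (by positivity)
  have hs : 0 < π * t / a ^ 2 := by positivity
  have hk : 1 ≤ a / √(π * t) := by
    rw [one_le_div hr]
    exact Real.sqrt_le_iff.2 ⟨ha.le, hπt⟩
  have hk2 : (a / √(π * t)) ^ 2 = a ^ 2 / (π * t) := by rw [div_pow, hr2]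
  have hsqrt : 1 / √(π * t / a ^ 2) = a / √(π * t) := by
    rw [Real.sqrt_div (by positivity), Real.sqrt_sq ha.le, one_div_div]
  have hexp : -π * (π * t / a ^ 2)⁻¹ = -a ^ 2 / t := by field_simp
  have hq : exp (-a ^ 2 / t) ≤ 1 / 2 := by
    have h1 : 1 ≤ a ^ 2 / t := by
      rw [one_le_div ht0]
      nlinarith [pi_gt_three]
    rw [neg_div, Real.exp_neg, one_div]
    exact inv_anti₀ two_pos (by linarith [Real.add_one_le_exp (a ^ 2 / t)])
  have hpoisson := one_add_two_mul_tsum_exp_neg_mul_succ_sq hs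
  rw [hsqrt, hexp] at hpoisson
  have hmain := abs_theta_sq_sub_le hk (exp_pos _).le hq hpoisson
    (tsum_pow_succ_sq_sub_nonneg (exp_pos _).le (by linarith))
    (tsum_pow_succ_sq_sub_le (exp_pos _).le hq)
  rw [← tsum_tsum_exp_neg_mul_succ_sq, hk2] at hmain
  have hterm (x : ℝ) : -(π ^ 2 * x) * t / a ^ 2 = -π * (π * t / a ^ 2) * x := by ring
  have hq2 : exp (-(2 * a ^ 2) / t) = exp (-a ^ 2 / t) ^ 2 := by
    rw [← Real.exp_nat_mul]
    push_cast
    ring_nf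
  simp_rw [hterm, hq2]
  rw [Real.norm_eq_abs, Real.norm_of_nonneg (by positivity)]
  convert hmain using 1
  · congr 3
    field_simp
  · field_simp
end

section
/- For every real q with 0 < q < 1, ∑_{m > n ≥ 1} q^{m² + mn + n²} = (Θ₃(q)·Θ₃(q³) + Θ₂(q)·Θ₂(q³) − 3·Θ₃(q) − 3·Θ₃(q³) + 5)/12, where Θ₃(q) = ∑_{n∈ℤ} q^{n²}, Θ₂(q) = ∑_{n∈ℤ} q^{(n+1/2)²}, and the left-hand sum is over integer pairs with m > n ≥ 1. -/
open Real

/-- The Jacobi theta function `Θ₃(q) = ∑_{n ∈ ℤ} q^{n²}`. -/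
noncomputable def theta3 (q : ℝ) : ℝ := ∑' n : ℤ, q ^ (n ^ 2)

/-- The Jacobi theta function `Θ₂(q) = ∑_{n ∈ ℤ} q^{(n+1/2)²}` (real exponents via `rpow`). -/
noncomputable def theta2 (q : ℝ) : ℝ := ∑' n : ℤ, q ^ (((n : ℝ) + 1 / 2) ^ 2)

/-- The squares of a shifted integer lattice give a summable Gaussian series at nome `q < 1`. -/
lemma summable_rpow_int_add_sq {q c : ℝ} (hq0 : 0 < q) (hq1 : q < 1) (hc0 : 0 ≤ c)
    (hc1 : c ≤ 1 / 2) : Summable fun n : ℤ => q ^ (((n : ℝ) + c) ^ 2) := by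
  have hgeom : Summable fun n : ℕ => q⁻¹ * q ^ n :=
    (summable_geometric_of_lt_one hq0.le hq1).mul_left _
  have hbound (n : ℕ) (x : ℝ) (hx : (n : ℝ) - 1 ≤ x) : q ^ x ≤ q⁻¹ * q ^ n := by
    rw [← rpow_natCast, ← rpow_neg_one, ← rpow_add hq0]
    exact rpow_le_rpow_of_exponent_ge hq0 hq1.le (by linarith)
  refine Summable.of_nat_of_neg_add_one ?_ ?_
  · refine Summable.of_nonneg_of_le (fun n => by positivity) (fun n => hbound n _ ?_) hgeom
    have : (0 : ℝ) ≤ n := n.cast_nonneg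
    push_cast
    nlinarith [sq_nonneg ((n : ℝ) - 1), mul_nonneg this hc0]
  · refine Summable.of_nonneg_of_le (fun n => by positivity) (fun n => hbound n _ ?_) hgeom
    have : (0 : ℝ) ≤ n := n.cast_nonneg
    push_cast
    nlinarith [sq_nonneg ((n : ℝ)), mul_nonneg this (sub_nonneg.2 hc1)]

lemma hasSum_theta2 {q : ℝ} (hq0 : 0 < q) (hq1 : q < 1) :
    HasSum (fun n : ℤ => q ^ (((n : ℝ) + 1 / 2) ^ 2)) (theta2 q) :=
  (summable_rpow_int_add_sq hq0 hq1 (by norm_num) le_rfl).hasSum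

lemma hasSum_theta3 {q : ℝ} (hq0 : 0 < q) (hq1 : q < 1) :
    HasSum (fun n : ℤ => q ^ (n ^ 2)) (theta3 q) := by
  refine Summable.hasSum ((summable_rpow_int_add_sq hq0 hq1 le_rfl (by norm_num)).congr ?_)
  intro n
  rw [← rpow_intCast]
  norm_num

lemma hasSum_theta3_pos {q : ℝ} (hq0 : 0 < q) (hq1 : q < 1) :
    HasSum (fun n : ℕ => q ^ (((n : ℤ) + 1) ^ 2)) ((theta3 q - 1) / 2) := by
  have hθ := hasSum_theta3 hq0 hq1
  have hs : Summable fun n : ℕ => q ^ (((n : ℤ) + 1) ^ 2) :=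
    hθ.summable.comp_injective (i := fun n : ℕ => (n : ℤ) + 1) fun a b h => by simpa using h
  have hnat : HasSum (fun n : ℕ => q ^ ((n : ℤ) ^ 2))
      (∑' n : ℕ, q ^ (((n : ℤ) + 1) ^ 2) + 1) := by
    have h0 : ∑ i ∈ Finset.range 1, q ^ ((i : ℤ) ^ 2) = 1 := by simp
    rw [← h0]
    exact (hasSum_nat_add_iff (f := fun n : ℕ => q ^ ((n : ℤ) ^ 2)) 1).1
      (by simpa using hs.hasSum)
  have hneg : HasSum (fun n : ℕ => q ^ ((-((n : ℤ) + 1)) ^ 2))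
      (∑' n : ℕ, q ^ (((n : ℤ) + 1) ^ 2)) := by
    simpa only [neg_sq] using hs.hasSum
  have := (HasSum.of_nat_of_neg_add_one (f := fun n : ℤ => q ^ (n ^ 2)) hnat hneg).unique hθ
  convert hs.hasSum using 1
  linarith

/-- The term `q ^ (m² + mn + n²)` of the theta series of the hexagonal lattice. -/
noncomputable def hexTerm (q : ℝ) (x : ℤ × ℤ) : ℝ := q ^ (x.1 ^ 2 + x.1 * x.2 + x.2 ^ 2)

/-- Rotation by a sixth of a turn of the hexagonal lattice. -/
def hexRotation : ℤ × ℤ ≃ ℤ × ℤ where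
  toFun x := (-x.2, x.1 + x.2)
  invFun x := (x.1 + x.2, -x.1)
  left_inv x := by ext <;> simp
  right_inv x := by ext <;> simp

lemma hexRotation_apply (m n : ℤ) : hexRotation (m, n) = (-n, m + n) := rfl

lemma hexTerm_hexRotation (q : ℝ) (x : ℤ × ℤ) : hexTerm q (hexRotation x) = hexTerm q x := by
  unfold hexTerm hexRotation
  congr 1
  simp
  ring

lemma hexTerm_swap (q : ℝ) (x : ℤ × ℤ) : hexTerm q x.swap = hexTerm q x := by
  unfold hexTerm
  congr 1
  simp
  ring

lemma hasSum_ite_of_injective {α β : Type*} {f : β → ℝ} {i : α → β} {P : β → Prop}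
    [DecidablePred P] {a : ℝ} (hi : i.Injective) (hP : ∀ x, P x ↔ ∃ y, i y = x)
    (h : HasSum (fun y => f (i y)) a) : HasSum (fun x => if P x then f x else 0) a := by
  refine (hi.hasSum_iff fun x hx => if_neg fun h' => hx ((hP x).1 h')).1 ?_
  convert h using 2 with y
  exact if_pos ((hP _).2 ⟨y, rfl⟩)

lemma hasSum_hexTerm {q : ℝ} (hq0 : 0 < q) (hq1 : q < 1) :
    HasSum (hexTerm q) (theta3 q * theta3 (q ^ 3) + theta2 q * theta2 (q ^ 3)) := by
  have hc0 : 0 < q ^ 3 := by positivity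
  have hc1 : q ^ 3 < 1 := pow_lt_one₀ hq0.le hq1 (by norm_num)
  have hprod {f g : ℤ → ℝ} {a b : ℝ} (hf : HasSum f a) (hg : HasSum g b) :
      HasSum (fun x : ℤ × ℤ => f x.1 * g x.2) (a * b) :=
    hf.mul hg (summable_mul_of_summable_norm hf.summable.norm hg.summable.norm)
  have heven : HasSum (fun x : ℤ × ℤ => if Even x.2 then hexTerm q x else 0)
      (theta3 q * theta3 (q ^ 3)) := by
    refine hasSum_ite_of_injective (i := fun x : ℤ × ℤ => (x.1 - x.2, 2 * x.2)) ?_ ?_ ?_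
    · rintro ⟨a, b⟩ ⟨c, d⟩ h
      simp only [Prod.mk.injEq] at h ⊢
      omega
    · rintro ⟨m, n⟩
      constructor
      · rintro ⟨k, hk⟩
        exact ⟨(m + k, k), by ext <;> simp_all; omega⟩
      · rintro ⟨⟨a, b⟩, h⟩
        simp only [Prod.mk.injEq] at h
        exact ⟨b, by simp only; omega⟩
    · convert hprod (hasSum_theta3 hq0 hq1) (hasSum_theta3 hc0 hc1) using 2 with x
      rw [hexTerm, ← zpow_natCast q 3, ← zpow_mul, ← zpow_add₀ hq0.ne']
      congr 1
      push_cast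
      ring
  have hodd : HasSum (fun x : ℤ × ℤ => if Odd x.2 then hexTerm q x else 0)
      (theta2 q * theta2 (q ^ 3)) := by
    refine hasSum_ite_of_injective (i := fun x : ℤ × ℤ => (x.1 - x.2, 2 * x.2 + 1)) ?_ ?_ ?_
    · rintro ⟨a, b⟩ ⟨c, d⟩ h
      simp only [Prod.mk.injEq] at h ⊢
      omega
    · rintro ⟨m, n⟩
      constructor
      · rintro ⟨k, hk⟩
        exact ⟨(m + k, k), by ext <;> simp_all⟩
      · rintro ⟨⟨a, b⟩, h⟩
        simp only [Prod.mk.injEq] at h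
        exact ⟨b, by simp only; omega⟩
    · convert hprod (hasSum_theta2 hq0 hq1) (hasSum_theta2 hc0 hc1) using 2 with x
      rw [hexTerm, ← rpow_natCast q 3, ← rpow_mul hq0.le, ← rpow_add hq0, ← rpow_intCast]
      congr 1
      push_cast
      ring
  convert heven.add hodd using 1
  ext x
  by_cases hx : Even x.2 <;> simp [hx, ← Int.not_even_iff_odd]

/-- The hexagonal lattice minus the origin is the disjoint union of the six rotations of a
half-open sector. -/
lemma hasSum_hexTerm_of_sector {q c : ℝ}
    (h : HasSum (fun x : ℤ × ℤ => if 1 ≤ x.1 ∧ 0 ≤ x.2 then hexTerm q x else 0) c) :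
    HasSum (hexTerm q) (1 + 6 * c) := by
  have hrot {g : ℤ × ℤ → ℝ} (hg : HasSum g c) : HasSum (fun x => g (hexRotation x)) c :=
    hexRotation.hasSum_iff.2 hg
  have h1 := hrot h
  have h2 := hrot h1
  have h3 := hrot h2
  have h4 := hrot h3
  have h5 := hrot h4
  have h0 : HasSum (fun x : ℤ × ℤ => if x = 0 then (1 : ℝ) else 0) 1 := hasSum_ite_eq 0 1
  convert h0.add (h.add (h1.add (h2.add (h3.add (h4.add h5))))) using 1
  · ext ⟨m, n⟩
    simp only [hexTerm_hexRotation]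
    simp only [hexRotation_apply, Prod.mk_eq_zero]
    by_cases hz : m = 0 ∧ n = 0
    · obtain ⟨rfl, rfl⟩ := hz
      simp [hexTerm]
    · clear * - hz
      grind
  · ring

/-- The half-open sector splits into an axis, a diagonal, and two mirror-image open sectors. -/
lemma hasSum_sector {q : ℝ} (hq0 : 0 < q) (hq1 : q < 1) :
    HasSum (fun x : ℤ × ℤ => if 1 ≤ x.1 ∧ 0 ≤ x.2 then hexTerm q x else 0)
      ((theta3 q - 1) / 2 + (theta3 (q ^ 3) - 1) / 2 +
        2 * ∑' p : {p : ℕ × ℕ // 1 ≤ p.2 ∧ p.2 < p.1},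
          q ^ (p.1.1 ^ 2 + p.1.1 * p.1.2 + p.1.2 ^ 2)) := by
  have hc0 : 0 < q ^ 3 := by positivity
  have hc1 : q ^ 3 < 1 := pow_lt_one₀ hq0.le hq1 (by norm_num)
  have haxis : HasSum (fun x : ℤ × ℤ => if 1 ≤ x.1 ∧ x.2 = 0 then hexTerm q x else 0)
      ((theta3 q - 1) / 2) := by
    refine hasSum_ite_of_injective (i := fun n : ℕ => ((n : ℤ) + 1, 0)) ?_ ?_ ?_
    · intro a b h
      simpa using h
    · rintro ⟨m, n⟩
      simp only [Prod.mk.injEq]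
      exact ⟨fun h => ⟨(m - 1).toNat, by omega⟩, by rintro ⟨y, hy⟩; omega⟩
    · convert hasSum_theta3_pos hq0 hq1 using 2 with n
      simp [hexTerm]
  have hdiag : HasSum (fun x : ℤ × ℤ => if 1 ≤ x.1 ∧ x.2 = x.1 then hexTerm q x else 0)
      ((theta3 (q ^ 3) - 1) / 2) := by
    refine hasSum_ite_of_injective (i := fun n : ℕ => ((n : ℤ) + 1, (n : ℤ) + 1)) ?_ ?_ ?_
    · intro a b h
      simpa using h
    · rintro ⟨m, n⟩
      simp only [Prod.mk.injEq]
      exact ⟨fun h => ⟨(m - 1).toNat, by omega⟩, by rintro ⟨y, hy⟩; omega⟩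
    · convert hasSum_theta3_pos hc0 hc1 using 2 with n
      rw [hexTerm, ← zpow_natCast q 3, ← zpow_mul]
      congr 1
      push_cast
      ring
  have hopen : HasSum (fun x : ℤ × ℤ => if 1 ≤ x.2 ∧ x.2 < x.1 then hexTerm q x else 0)
      (∑' p : {p : ℕ × ℕ // 1 ≤ p.2 ∧ p.2 < p.1},
          q ^ (p.1.1 ^ 2 + p.1.1 * p.1.2 + p.1.2 ^ 2)) := by
    let i : {p : ℕ × ℕ // 1 ≤ p.2 ∧ p.2 < p.1} → ℤ × ℤ := fun p => (p.1.1, p.1.2)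
    have hi : i.Injective := by
      rintro ⟨⟨a, b⟩, _⟩ ⟨⟨c, d⟩, _⟩ h
      simpa [i] using h
    have hterm (p) : hexTerm q (i p) = q ^ (p.1.1 ^ 2 + p.1.1 * p.1.2 + p.1.2 ^ 2) := by
      rw [hexTerm, ← zpow_natCast]
      congr 1
    refine hasSum_ite_of_injective hi ?_ ?_
    · rintro ⟨m, n⟩
      constructor
      · rintro ⟨h1, h2⟩
        simp only at h1 h2
        refine ⟨⟨(m.toNat, n.toNat), by simp only; omega⟩, ?_⟩
        simp only [i, Prod.mk.injEq]
        omega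
      · rintro ⟨⟨⟨a, b⟩, h1, h2⟩, h⟩
        simp only [i, Prod.mk.injEq] at h h1 h2 ⊢
        omega
    · simp only [← hterm]
      exact ((hasSum_hexTerm hq0 hq1).summable.comp_injective hi).hasSum
  have hmirror := (Equiv.prodComm ℤ ℤ).hasSum_iff.2 hopen
  convert (haxis.add hdiag).add (hopen.add hmirror) using 1
  · ext ⟨m, n⟩
    simp only [Function.comp_apply, Equiv.prodComm_apply, hexTerm_swap, Prod.fst_swap,
      Prod.snd_swap]
    split_ifs <;> first | omega | simp
  · ring

/-- **Closed theta form of the Dirichlet heat trace of the hemi-equilateral triangle:**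
for `0 < q < 1`,
`∑_{m > n ≥ 1} q^{m² + mn + n²} = (Θ₃(q)Θ₃(q³) + Θ₂(q)Θ₂(q³) − 3Θ₃(q) − 3Θ₃(q³) + 5)/12`. -/
theorem hemiEquilateral_heat_trace_theta (q : ℝ) (hq0 : 0 < q) (hq1 : q < 1) :
    ∑' p : {p : ℕ × ℕ // 1 ≤ p.2 ∧ p.2 < p.1}, q ^ (p.1.1 ^ 2 + p.1.1 * p.1.2 + p.1.2 ^ 2)
      = (theta3 q * theta3 (q ^ 3) + theta2 q * theta2 (q ^ 3)
          - 3 * theta3 q - 3 * theta3 (q ^ 3) + 5) / 12 := by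
  have h := (hasSum_hexTerm hq0 hq1).unique (hasSum_hexTerm_of_sector (hasSum_sector hq0 hq1))
  linarith
end
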